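/- arXiv:1803.02908 — 2 statements merged into one kernel-verified Lean document; each statement's English description precedes it below -/
import Mathlib

section
/- Let R, β, γ be positive real numbers and define V : ℝ × ℝ → ℝ by V(z₁, z₂) = R²·(γ/β)·ln(cosh(β·z₁/γ)) + z₂²/2. Then V is radially unbounded: V(z) → ∞ as ‖z‖ → ∞, i.e. for every M > 0 there exists K > 0 such that ‖(z₁,z₂)‖ ≥ K implies V(z₁,z₂) ≥ M. -/
theorem log_cosh_lower (x : ℝ) : |x| - Real.log 2 ≤ Real.log (Real.cosh x) := by
  have h : Real.exp |x| / 2 ≤ Real.cosh x := by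
    rw [← Real.cosh_abs, Real.cosh_eq]
    have := Real.exp_pos (-|x|)
    linarith
  have h2 := Real.log_le_log (by positivity) h
  rwa [Real.log_div (Real.exp_pos _).ne' two_ne_zero, Real.log_exp] at h2

/-- Radial unboundedness (coercivity) of the INTD Lyapunov function. -/
theorem intd_lyapunov_radially_unbounded (R β γ : ℝ) (hR : 0 < R) (hβ : 0 < β) (hγ : 0 < γ)
    (V : ℝ × ℝ → ℝ)
    (hV : ∀ z : ℝ × ℝ,
      V z = R ^ 2 * (γ / β) * Real.log (Real.cosh (β * z.1 / γ)) + z.2 ^ 2 / 2) :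
    ∀ M : ℝ, 0 < M → ∃ K : ℝ, 0 < K ∧ ∀ z : ℝ × ℝ, K ≤ ‖z‖ → M ≤ V z := by
  intro M hM
  have hl : 0 < Real.log 2 := Real.log_pos one_lt_two
  have hc : 0 < R ^ 2 * (γ / β) := by positivity
  have hA : 0 < (M + R ^ 2 * (γ / β) * Real.log 2) / R ^ 2 := by positivity
  refine ⟨(M + R ^ 2 * (γ / β) * Real.log 2) / R ^ 2 + (2 * M + 1), by positivity, ?_⟩
  intro z hz
  rw [hV]
  rw [Prod.norm_def, le_max_iff, Real.norm_eq_abs, Real.norm_eq_abs] at hz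
  rcases hz with hz | hz
  · have h1 := mul_le_mul_of_nonneg_left (log_cosh_lower (β * z.1 / γ)) hc.le
    have h2 : R ^ 2 * (γ / β) * |β * z.1 / γ| = R ^ 2 * |z.1| := by
      rw [abs_div, abs_mul, abs_of_pos hβ, abs_of_pos hγ]
      field_simp
    have h3 : (M + R ^ 2 * (γ / β) * Real.log 2) / R ^ 2 ≤ |z.1| := by linarith
    rw [div_le_iff₀ (by positivity)] at h3
    rw [mul_sub, h2] at h1
    have := sq_nonneg z.2
    linarith
  · have h1 : 0 ≤ Real.log (Real.cosh (β * z.1 / γ)) := Real.log_nonneg (Real.one_le_cosh _)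
    have h2 := mul_nonneg hc.le h1
    have h3 : 2 * M + 1 ≤ |z.2| := by linarith
    have h4 : 2 * M ≤ z.2 ^ 2 := by
      rw [← sq_abs]
      nlinarith
    linarith
end

section
/- Let R, β, γ be positive real numbers. For every solution z = (z₁, z₂) : [0,∞) → ℝ² of the system z₁' = z₂, z₂' = -R²·tanh(β·z₁/γ) - R·z₂ (with arbitrary initial condition z(0) ∈ ℝ²), one has z₁(t) → 0 and z₂(t) → 0 as t → ∞. (Global asymptotic stability of the origin for the unforced INTD.) -/
lemma intd_anti (f f' : ℝ → ℝ)
    (h : ∀ t ∈ Set.Ici (0 : ℝ), HasDerivWithinAt f (f' t) (Set.Ici 0) t)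
    (h' : ∀ t ∈ Set.Ici (0 : ℝ), f' t ≤ 0) : ∀ t, 0 ≤ t → f t ≤ f 0 := by
  have : AntitoneOn f (Set.Ici 0) := by
    apply antitoneOn_of_hasDerivWithinAt_nonpos (convex_Ici 0) (f' := f')
    · exact fun t ht => (h t ht).continuousWithinAt
    · exact fun t ht => (h t (interior_subset ht)).mono interior_subset
    · exact fun t ht => h' t (interior_subset ht)
  intro t ht
  exact this (Set.mem_Ici.2 le_rfl) ht ht

lemma intd_tanh_nonneg (x : ℝ) (hx : 0 ≤ x) : x ^ 2 ≤ x * Real.tanh x * (1 + x) := by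
  have hE : 2 * x + 1 ≤ Real.exp (2 * x) := Real.add_one_le_exp _
  have h1 : Real.exp (2 * x) = Real.exp x * Real.exp x := by rw [← Real.exp_add]; ring_nf
  have h2 : Real.exp x * Real.exp (-x) = 1 := by rw [← Real.exp_add]; simp
  have hp := Real.exp_pos x
  have hn := Real.exp_pos (-x)
  have key : x ≤ Real.tanh x * (1 + x) := by
    rw [Real.tanh_eq_sinh_div_cosh, div_mul_eq_mul_div, le_div_iff₀ (Real.cosh_pos x),
      Real.sinh_eq, Real.cosh_eq]
    have h3 : (2 * x + 1) * Real.exp (-x) ≤ Real.exp x := by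
      calc _ ≤ Real.exp (2 * x) * Real.exp (-x) := by gcongr
        _ = Real.exp x := by rw [h1, mul_assoc, h2, mul_one]
    nlinarith
  nlinarith

lemma intd_tanh (x : ℝ) : x ^ 2 ≤ x * Real.tanh x * (1 + |x|) := by
  rcases le_total 0 x with h | h
  · rw [abs_of_nonneg h]; exact intd_tanh_nonneg x h
  · rw [abs_of_nonpos h]
    have := intd_tanh_nonneg (-x) (by linarith)
    rw [Real.tanh_neg] at this
    nlinarith

/-- Global asymptotic stability of the origin for the unforced INTD:
every solution of `ż₁ = z₂`, `ż₂ = -R²·tanh(β·z₁/γ) - R·z₂` on `[0,∞)` converges to `0`. -/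
theorem intd_global_asymptotic_stability (R β γ : ℝ) (hR : 0 < R) (hβ : 0 < β) (hγ : 0 < γ)
    (z₁ z₂ : ℝ → ℝ)
    (hz₁ : ∀ t ∈ Set.Ici (0 : ℝ), HasDerivWithinAt z₁ (z₂ t) (Set.Ici 0) t)
    (hz₂ : ∀ t ∈ Set.Ici (0 : ℝ),
      HasDerivWithinAt z₂ (-R ^ 2 * Real.tanh (β * z₁ t / γ) - R * z₂ t) (Set.Ici 0) t) :
    Filter.Tendsto z₁ Filter.atTop (nhds 0) ∧ Filter.Tendsto z₂ Filter.atTop (nhds 0) := by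
  obtain ⟨k, hk⟩ : ∃ k, k = β / γ := ⟨_, rfl⟩
  have hk0 : 0 < k := hk ▸ div_pos hβ hγ
  have hkx : ∀ x, β * x / γ = k * x := fun x => by rw [hk]; ring
  simp only [hkx] at hz₂
  obtain ⟨W, hW⟩ : ∃ W : ℝ → ℝ, W = fun t => 2 * (R ^ 2 / k * Real.log (Real.cosh (k * z₁ t)))
    + z₂ t ^ 2 / 2 + (R * z₁ t + z₂ t) ^ 2 / 2 := ⟨_, rfl⟩
  obtain ⟨D, hD⟩ : ∃ D : ℝ → ℝ, D = fun t => -(R * z₂ t ^ 2)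
    - R ^ 3 * (z₁ t * Real.tanh (k * z₁ t)) := ⟨_, rfl⟩
  have hWD : ∀ t ∈ Set.Ici (0 : ℝ), HasDerivWithinAt W (D t) (Set.Ici 0) t := by
    intro t ht
    have a := hz₁ t ht
    have b := hz₂ t ht
    have hc := (Real.cosh_pos (k * z₁ t)).ne'
    have l := ((a.const_mul k).cosh.log hc).const_mul (R ^ 2 / k) |>.const_mul 2
    have := (l.add ((b.pow 2).div_const 2)).add ((((a.const_mul R).add b).pow 2).div_const 2)
    rw [hW]
    refine this.congr_deriv ?_
    rw [hD]
    simp only [Real.tanh_eq_sinh_div_cosh, Pi.add_apply]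
    field_simp
    ring
  have hx : ∀ t, k * z₁ t ^ 2 ≤ z₁ t * Real.tanh (k * z₁ t) * (1 + k * |z₁ t|) := by
    intro t
    have := intd_tanh (k * z₁ t)
    rw [abs_mul, abs_of_pos hk0] at this
    refine le_of_mul_le_mul_left ?_ hk0
    linarith
  have hx0 : ∀ t, 0 ≤ z₁ t * Real.tanh (k * z₁ t) := by
    intro t
    have h1 : 0 < 1 + k * |z₁ t| := by positivity
    exact nonneg_of_mul_nonneg_left ((by positivity : 0 ≤ k * z₁ t ^ 2).trans (hx t)) h1
  have hD0 : ∀ t ∈ Set.Ici (0 : ℝ), D t ≤ 0 := by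
    intro t _
    rw [hD]
    have := mul_nonneg (pow_pos hR 3).le (hx0 t)
    have : 0 ≤ R * z₂ t ^ 2 := by positivity
    simp only
    linarith
  have hWm := intd_anti W D hWD hD0
  have hlow : ∀ t, z₂ t ^ 2 / 2 + (R * z₁ t + z₂ t) ^ 2 / 2 ≤ W t := by
    intro t
    have : 0 ≤ Real.log (Real.cosh (k * z₁ t)) := Real.log_nonneg (Real.one_le_cosh _)
    have : 0 ≤ R ^ 2 / k * Real.log (Real.cosh (k * z₁ t)) := by positivity
    rw [hW]; simp only; linarith
  have hlow1 : ∀ t, (R * z₁ t) ^ 2 ≤ 4 * W t := by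
    intro t
    nlinarith [hlow t, sq_nonneg (R * z₁ t + 2 * z₂ t)]
  have hlow2 : ∀ t, z₂ t ^ 2 ≤ 2 * W t := by
    intro t
    nlinarith [hlow t, sq_nonneg (R * z₁ t + z₂ t)]
  have hW0 : ∀ t, 0 ≤ W t := fun t => by nlinarith [hlow2 t, sq_nonneg (z₂ t)]
  obtain ⟨M, hM⟩ : ∃ M, M = (1 + 4 * W 0) / R := ⟨_, rfl⟩
  have hM0 : 0 < M := by rw [hM]; have := hW0 0; positivity
  have hzM : ∀ t, 0 ≤ t → |z₁ t| ≤ M := by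
    intro t ht
    rw [hM, le_div_iff₀ hR]
    have : |R * z₁ t| ≤ 1 + 4 * W 0 := by
      apply abs_le_of_sq_le_sq
      · nlinarith [hlow1 t, hWm t ht, hW0 0]
      · linarith [hW0 0]
    rw [abs_mul, abs_of_pos hR] at this
    linarith
  obtain ⟨c, hc⟩ : ∃ c, c = k / (1 + k * M) := ⟨_, rfl⟩
  have hc0 : 0 < c := by rw [hc]; positivity
  have hcx : ∀ t, 0 ≤ t → c * z₁ t ^ 2 ≤ z₁ t * Real.tanh (k * z₁ t) := by
    intro t ht
    rw [hc, div_mul_eq_mul_div, div_le_iff₀ (by positivity)]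
    refine (hx t).trans (mul_le_mul_of_nonneg_left ?_ (hx0 t))
    have := mul_le_mul_of_nonneg_left (hzM t ht) hk0.le
    linarith
  have hup : ∀ t, W t ≤ R ^ 2 * (k + 1) * z₁ t ^ 2 + 3 / 2 * z₂ t ^ 2 := by
    intro t
    have h1 : Real.log (Real.cosh (k * z₁ t)) ≤ (k * z₁ t) ^ 2 / 2 :=
      (Real.log_le_iff_le_exp (Real.cosh_pos _)).2 (Real.cosh_le_exp_half_sq _)
    have h2 := mul_le_mul_of_nonneg_left h1 (by positivity : 0 ≤ R ^ 2 / k)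
    have h3 : R ^ 2 / k * ((k * z₁ t) ^ 2 / 2) = R ^ 2 * k * z₁ t ^ 2 / 2 := by field_simp
    rw [hW]; simp only
    nlinarith [sq_nonneg (R * z₁ t - z₂ t)]
  obtain ⟨l, hl⟩ : ∃ l, l = min (R * c / (k + 1)) (2 * R / 3) := ⟨_, rfl⟩
  have hl0 : 0 < l := by rw [hl]; positivity
  have hl1 : l * (k + 1) ≤ R * c := by
    rw [← le_div_iff₀ (by positivity), hl]; exact min_le_left _ _
  have hl2 : l ≤ 2 * R / 3 := by rw [hl]; exact min_le_right _ _
  have hDW : ∀ t, 0 ≤ t → D t + l * W t ≤ 0 := by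
    intro t ht
    have h1 := mul_le_mul_of_nonneg_left (hup t) hl0.le
    have h2 := mul_le_mul_of_nonneg_left (hcx t ht) (pow_pos hR 3).le
    have h3 := mul_le_mul_of_nonneg_right hl1 (by positivity : 0 ≤ R ^ 2 * z₁ t ^ 2)
    have h4 := mul_le_mul_of_nonneg_right hl2 (by positivity : 0 ≤ z₂ t ^ 2)
    rw [hD]; simp only
    linarith
  have hexp := intd_anti (fun t => Real.exp (l * t) * W t)
    (fun t => Real.exp (l * t) * (D t + l * W t))
    (by
      intro t ht
      have e := (((hasDerivAt_id t).const_mul l).exp).hasDerivWithinAt (s := Set.Ici 0)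
      refine (e.mul (hWD t ht)).congr_deriv ?_
      simp only [id]
      ring)
    (fun t ht => mul_nonpos_of_nonneg_of_nonpos (Real.exp_pos _).le (hDW t ht))
  have hbd : ∀ t, 0 ≤ t → W t ≤ Real.exp (-(l * t)) * W 0 := by
    intro t ht
    have := hexp t ht
    simp only [mul_zero, Real.exp_zero, one_mul] at this
    rw [Real.exp_neg, inv_mul_eq_div, le_div_iff₀ (Real.exp_pos _)]
    linarith
  have hWt : Filter.Tendsto W Filter.atTop (nhds 0) := by
    have h1 : Filter.Tendsto (fun t => Real.exp (-(l * t)) * W 0) Filter.atTop (nhds 0) := by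
      have := (Real.tendsto_exp_neg_atTop_nhds_zero.comp
        (Filter.tendsto_id.const_mul_atTop hl0)).mul_const (W 0)
      simpa using this
    refine squeeze_zero' (Filter.Eventually.of_forall hW0) ?_ h1
    filter_upwards [Filter.eventually_ge_atTop 0] with t ht using hbd t ht
  have hsq : ∀ f : ℝ → ℝ, ∀ C : ℝ, (∀ t, f t ^ 2 ≤ C * W t) →
      Filter.Tendsto f Filter.atTop (nhds 0) := by
    intro f C hf
    have h1 : Filter.Tendsto (fun t => Real.sqrt (C * W t)) Filter.atTop (nhds 0) := by
      simpa using (hWt.const_mul C).sqrt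
    exact squeeze_zero_norm (fun t => Real.abs_le_sqrt (hf t)) h1
  refine ⟨hsq z₁ (4 / R ^ 2) fun t => ?_, hsq z₂ 2 hlow2⟩
  have := hlow1 t
  rw [div_mul_eq_mul_div, le_div_iff₀ (by positivity)]
  linarith
end
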